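/- arXiv:1611.01335 — 2 statements merged into one kernel-verified Lean document; each statement's English description precedes it below -/
import Mathlib

section
/- Let X_1, …, X_n be i.i.d. random variables taking values in a finite subset of ℝ, and for 1 ≤ ℓ ≤ n set S_ℓ = X_1 + ⋯ + X_ℓ. Then for every 1 ≤ m ≤ n and every function Φ in the class 𝓕, the Φ-SDPI constant satisfies η_Φ(S_n, S_m) = m/n. -/
open Finset

noncomputable section

/-- A probability mass function on a finite type. -/
def IsPMF {Ω : Type*} [Fintype Ω] (p : Ω → ℝ) : Prop :=
  (∀ ω, 0 ≤ p ω) ∧ ∑ ω, p ω = 1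

/-- Expectation of `f` under the pmf `p`. -/
def expect {Ω : Type*} [Fintype Ω] (p : Ω → ℝ) (f : Ω → ℝ) : ℝ :=
  ∑ ω, p ω * f ω

/-- Variance of `f` under the pmf `p`. -/
def var {Ω : Type*} [Fintype Ω] (p : Ω → ℝ) (f : Ω → ℝ) : ℝ :=
  ∑ ω, p ω * (f ω - expect p f) ^ 2

open scoped Classical in
/-- Conditional expectation `E[f | X]`, as a function on the sample space. -/
def condExp {Ω β : Type*} [Fintype Ω] (p : Ω → ℝ) (f : Ω → ℝ) (X : Ω → β) : Ω → ℝ :=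
  fun ω => (∑ ω', if X ω' = X ω then p ω' * f ω' else 0) /
    (∑ ω', if X ω' = X ω then p ω' else 0)

/-- The Φ-entropy `H_Φ(f) = E[Φ(f)] - Φ(E[f])`. -/
def Hphi {Ω : Type*} [Fintype Ω] (Φ : ℝ → ℝ) (p : Ω → ℝ) (f : Ω → ℝ) : ℝ :=
  expect p (fun ω => Φ (f ω)) - Φ (expect p f)

/-- The conditional Φ-entropy `H_Φ(f | X) = E[Φ(f)] - E[Φ(E[f|X])]`. -/
def HphiCond {Ω β : Type*} [Fintype Ω] (Φ : ℝ → ℝ) (p : Ω → ℝ) (f : Ω → ℝ) (X : Ω → β) : ℝ :=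
  expect p (fun ω => Φ (f ω)) - expect p (fun ω => Φ (condExp p f X ω))

/-- The class 𝓕 of smooth convex non-affine functions `Φ` on a convex domain `D ⊆ ℝ`
such that for every `q ∈ [0,1]` the map
`(s,t) ↦ q Φ(s) + (1-q) Φ(t) - Φ(q s + (1-q) t)` is jointly convex. -/
structure ClassF where
  D : Set ℝ
  Φ : ℝ → ℝ
  convex_dom : Convex ℝ D
  smooth : ContDiffOn ℝ (⊤ : ℕ∞) Φ D
  convexOn : ConvexOn ℝ D Φ
  not_affine : ¬ ∃ a b : ℝ, ∀ t ∈ D, Φ t = a * t + b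
  joint_convex : ∀ q ∈ Set.Icc (0:ℝ) 1,
    ConvexOn ℝ (D ×ˢ D)
      (fun st : ℝ × ℝ => q * Φ st.1 + (1 - q) * Φ st.2 - Φ (q * st.1 + (1 - q) * st.2))

/-- The Φ-SDPI constant `η_Φ(X, Y)` for random variables `X : Ω → S`, `Y : Ω → T` on a finite
probability space `(Ω, p)`: the infimum of all `λ ≥ 0` such that `λ H_Φ(f(X)) ≥ H_Φ(E[f(X)|Y])`
for every function `f` of `X` whose range lies in `D`. -/
def etaPhiRV {Ω S T : Type} [Fintype Ω] (Φ : ℝ → ℝ) (D : Set ℝ)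
    (p : Ω → ℝ) (X : Ω → S) (Y : Ω → T) : ℝ :=
  sInf {l : ℝ | 0 ≤ l ∧ ∀ f : S → ℝ, (∀ ω, f (X ω) ∈ D) →
    l * Hphi Φ p (fun ω => f (X ω)) ≥ Hphi Φ p (condExp p (fun ω => f (X ω)) Y)}

/-- The operator `f ↦ (s ↦ E[f (s + X)])` for a variable `X` with values `v` and weights `μ`. -/
def shiftAvg {ι : Type*} [Fintype ι] (μ v : ι → ℝ) : Module.End ℝ (ℝ → ℝ) where
  toFun f s := ∑ x, μ x * f (s + v x)
  map_add' f g := by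
    ext s
    simp [mul_add, Finset.sum_add_distrib]
  map_smul' c f := by
    ext s
    simp only [Pi.smul_apply, smul_eq_mul, RingHom.id_apply, Finset.mul_sum]
    exact Finset.sum_congr rfl fun _ _ => by ring

section ShiftAvg

variable {ι : Type*} [Fintype ι] {μ v : ι → ℝ}

lemma shiftAvg_apply (f : ℝ → ℝ) (s : ℝ) :
    shiftAvg μ v f s = ∑ x, μ x * f (s + v x) := rfl

lemma shiftAvg_pow_succ_apply (k : ℕ) (f : ℝ → ℝ) (s : ℝ) :
    (shiftAvg μ v ^ (k + 1)) f s = ∑ x, μ x * (shiftAvg μ v ^ k) f (s + v x) := by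
  rw [pow_succ', Module.End.mul_apply, shiftAvg_apply]

lemma shiftAvg_pow_mono (hμ0 : ∀ x, 0 ≤ μ x) {f g : ℝ → ℝ} (h : ∀ s, f s ≤ g s) (k : ℕ) (s : ℝ) :
    (shiftAvg μ v ^ k) f s ≤ (shiftAvg μ v ^ k) g s := by
  induction k generalizing s with
  | zero => simpa using h s
  | succ k ih =>
    simp only [shiftAvg_pow_succ_apply]
    exact Finset.sum_le_sum fun x _ => mul_le_mul_of_nonneg_left (ih _) (hμ0 x)

lemma shiftAvg_pow_const (hμ1 : ∑ x, μ x = 1) (c : ℝ) (k : ℕ) (s : ℝ) :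
    (shiftAvg μ v ^ k) (fun _ => c) s = c := by
  induction k generalizing s with
  | zero => simp
  | succ k ih =>
    rw [shiftAvg_pow_succ_apply]
    simp [ih, ← Finset.sum_mul, hμ1]

lemma shiftAvg_pow_mem (hμ0 : ∀ x, 0 ≤ μ x) (hμ1 : ∑ x, μ x = 1) {D : Set ℝ} (hD : Convex ℝ D)
    {f : ℝ → ℝ} (h : ∀ s, f s ∈ D) (k : ℕ) (s : ℝ) : (shiftAvg μ v ^ k) f s ∈ D := by
  induction k generalizing s with
  | zero => simpa using h s
  | succ k ih =>
    rw [shiftAvg_pow_succ_apply]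
    exact hD.sum_mem (fun x _ => hμ0 x) hμ1 fun x _ => ih _

lemma shiftAvg_pow_tendsto {α : Type*} {l : Filter α} {f : α → ℝ → ℝ} {g : ℝ → ℝ}
    (h : ∀ s, Filter.Tendsto (fun a => f a s) l (nhds (g s))) (k : ℕ) (s : ℝ) :
    Filter.Tendsto (fun a => (shiftAvg μ v ^ k) (f a) s) l (nhds ((shiftAvg μ v ^ k) g s)) := by
  induction k generalizing s with
  | zero => simpa using h s
  | succ k ih =>
    simp only [shiftAvg_pow_succ_apply]
    exact tendsto_finsetSum _ fun x _ => (ih _).const_mul _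

lemma shiftAvg_pow_sub_const (hμ1 : ∑ x, μ x = 1) (c : ℝ) (k : ℕ) (s : ℝ) :
    (shiftAvg μ v ^ k) (fun t => t - c) s = s + k * ∑ x, μ x * v x - c := by
  induction k generalizing s with
  | zero => simp
  | succ k ih =>
    rw [shiftAvg_pow_succ_apply]
    simp only [ih]
    have (x : ι) : μ x * (s + v x + k * ∑ x, μ x * v x - c)
        = (s + k * ∑ x, μ x * v x - c) * μ x + μ x * v x := by ring
    simp only [this, Finset.sum_add_distrib, ← Finset.mul_sum, hμ1]
    push_cast
    ring

lemma shiftAvg_pow_sq (hμ1 : ∑ x, μ x = 1) (c : ℝ) (k : ℕ) (s : ℝ) :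
    (shiftAvg μ v ^ k) (fun t => (t - c) ^ 2) s
      = (s + k * ∑ x, μ x * v x - c) ^ 2 + k * var μ v := by
  induction k generalizing s with
  | zero => simp
  | succ k ih =>
    rw [shiftAvg_pow_succ_apply]
    simp only [ih]
    set e := ∑ x, μ x * v x with he
    have hvar : var μ v = ∑ x, μ x * (v x - e) ^ 2 := rfl
    have (x : ι) : μ x * ((s + v x + k * e - c) ^ 2 + k * var μ v)
        = ((s + (k + 1) * e - c) ^ 2 + k * var μ v - 2 * (s + (k + 1) * e - c) * e) * μ x
          + 2 * (s + (k + 1) * e - c) * (μ x * v x) + μ x * (v x - e) ^ 2 := by ring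
    simp only [this, Finset.sum_add_distrib, ← Finset.mul_sum, hμ1, ← he, ← hvar]
    push_cast
    ring

/-- The joint law of the partial sums, expressed through `shiftAvg`. -/
lemma sum_pi_partialSum (n : ℕ) :
    ∀ m ≤ n, ∀ (s : ℝ) (A f : ℝ → ℝ),
      ∑ ω : Fin n → ι, (∏ i, μ (ω i)) *
          (A (s + ∑ i, if i.val < m then v (ω i) else 0) * f (s + ∑ i, v (ω i)))
        = (shiftAvg μ v ^ m) (A * (shiftAvg μ v ^ (n - m)) f) s := by
  induction n with
  | zero =>
    intro m hm s A f
    obtain rfl : m = 0 := by omega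
    simp
  | succ n ih =>
    intro m hm s A f
    rw [← (Fin.consEquiv fun _ => ι).sum_comp, Fintype.sum_prod_type]
    cases m with
    | zero =>
      simp only [Fin.consEquiv, Equiv.coe_fn_mk, Fin.prod_univ_succ, Fin.sum_univ_succ,
        Fin.cons_zero, Fin.cons_succ, Nat.not_lt_zero, if_false, Finset.sum_const_zero, add_zero,
        pow_zero, Module.End.one_apply, Nat.sub_zero, Pi.mul_apply, shiftAvg_pow_succ_apply,
        Finset.mul_sum]
      refine Finset.sum_congr rfl fun x _ => ?_
      have := ih 0 (Nat.zero_le _) (s + v x) (fun _ => A s) f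
      simp only [pow_zero, Module.End.one_apply, Nat.sub_zero, Pi.mul_apply] at this
      rw [mul_left_comm, ← this, Finset.mul_sum]
      exact Finset.sum_congr rfl fun ω _ => by rw [← add_assoc]; ring
    | succ m =>
      simp only [Fin.consEquiv, Equiv.coe_fn_mk, Fin.prod_univ_succ, Fin.sum_univ_succ,
        Fin.cons_zero, Fin.cons_succ, Fin.val_zero, Fin.val_succ, Nat.zero_lt_succ, if_true,
        add_lt_add_iff_right, shiftAvg_pow_succ_apply, Nat.add_sub_add_right]
      refine Finset.sum_congr rfl fun x _ => ?_
      rw [← ih m (by omega) (s + v x) A f, Finset.mul_sum]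
      exact Finset.sum_congr rfl fun ω _ => by simp only [← add_assoc]; ring

lemma expect_totalSum (n : ℕ) (f : ℝ → ℝ) :
    expect (fun ω : Fin n → ι => ∏ i, μ (ω i)) (fun ω => f (∑ i, v (ω i)))
      = (shiftAvg μ v ^ n) f 0 := by
  have := sum_pi_partialSum (μ := μ) (v := v) n 0 (Nat.zero_le _) 0 1 f
  simpa [_root_.expect] using this

lemma expect_partialSum (hμ1 : ∑ x, μ x = 1) {n m : ℕ} (hmn : m ≤ n) (A : ℝ → ℝ) :
    expect (fun ω : Fin n → ι => ∏ i, μ (ω i))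
        (fun ω => A (∑ i, if i.val < m then v (ω i) else 0))
      = (shiftAvg μ v ^ m) A 0 := by
  have := sum_pi_partialSum (μ := μ) (v := v) n m hmn 0 A (fun _ => 1)
  have h1 : (shiftAvg μ v ^ (n - m)) (fun _ => (1 : ℝ)) = 1 := by
    ext s
    exact shiftAvg_pow_const hμ1 1 _ s
  rw [h1, mul_one] at this
  simpa [_root_.expect] using this

lemma condExp_totalSum (hμ0 : ∀ x, 0 ≤ μ x) (hμ1 : ∑ x, μ x = 1) {n m : ℕ} (hmn : m ≤ n)
    (f : ℝ → ℝ) (ω : Fin n → ι) (hω : ∏ i, μ (ω i) ≠ 0) :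
    condExp (fun ω : Fin n → ι => ∏ i, μ (ω i)) (fun ω => f (∑ i, v (ω i)))
        (fun ω => ∑ i, if i.val < m then v (ω i) else 0) ω
      = (shiftAvg μ v ^ (n - m)) f (∑ i, if i.val < m then v (ω i) else 0) := by
  classical
  set c : ℝ := ∑ i, if i.val < m then v (ω i) else 0 with hc
  let A : ℝ → ℝ := fun t => if t = c then 1 else 0
  have hnum := sum_pi_partialSum (μ := μ) (v := v) n m hmn 0 A f
  have hden := expect_partialSum (v := v) hμ1 hmn A
  have hA : A * (shiftAvg μ v ^ (n - m)) f = (shiftAvg μ v ^ (n - m)) f c • A := by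
    ext t
    by_cases ht : t = c <;> simp [A, ht]
  rw [hA, map_smul, Pi.smul_apply, smul_eq_mul, ← hden] at hnum
  have hpos : expect (fun ω : Fin n → ι => ∏ i, μ (ω i))
      (fun ω => A (∑ i, if i.val < m then v (ω i) else 0)) ≠ 0 := by
    have hp (ω : Fin n → ι) : 0 ≤ ∏ i, μ (ω i) := Finset.prod_nonneg fun i _ => hμ0 _
    refine ((lt_of_le_of_ne (hp ω) hω.symm).trans_le ?_).ne'
    have := Finset.single_le_sum (s := Finset.univ)
      (f := fun ω : Fin n → ι => (∏ i, μ (ω i)) * A (∑ i, if i.val < m then v (ω i) else 0))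
      (fun ω' _ => mul_nonneg (hp ω') (by simp only [A]; split_ifs <;> norm_num))
      (Finset.mem_univ ω)
    simpa [A, ← hc, _root_.expect] using this
  rw [← mul_div_cancel_right₀ ((shiftAvg μ v ^ (n - m)) f c) hpos, ← hnum, condExp]
  congr 1
  · refine Finset.sum_congr rfl fun ω' _ => ?_
    simp only [A, ← hc]
    split_ifs <;> simp_all
  · refine Finset.sum_congr rfl fun ω' _ => ?_
    simp only [A, ← hc]
    split_ifs <;> simp_all

lemma Hphi_totalSum (Φ : ℝ → ℝ) (n : ℕ) (f : ℝ → ℝ) :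
    Hphi Φ (fun ω : Fin n → ι => ∏ i, μ (ω i)) (fun ω => f (∑ i, v (ω i)))
      = (shiftAvg μ v ^ n) (Φ ∘ f) 0 - Φ ((shiftAvg μ v ^ n) f 0) := by
  rw [Hphi, expect_totalSum n f]
  exact congrArg (· - _) (expect_totalSum n (Φ ∘ f))

lemma Hphi_condExp_totalSum (hμ0 : ∀ x, 0 ≤ μ x) (hμ1 : ∑ x, μ x = 1) (Φ : ℝ → ℝ) {n m : ℕ}
    (hmn : m ≤ n) (f : ℝ → ℝ) :
    Hphi Φ (fun ω : Fin n → ι => ∏ i, μ (ω i))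
        (condExp (fun ω : Fin n → ι => ∏ i, μ (ω i)) (fun ω => f (∑ i, v (ω i)))
          (fun ω => ∑ i, if i.val < m then v (ω i) else 0))
      = (shiftAvg μ v ^ m) (Φ ∘ (shiftAvg μ v ^ (n - m)) f) 0
        - Φ ((shiftAvg μ v ^ n) f 0) := by
  have key (Ψ : ℝ → ℝ) : expect (fun ω : Fin n → ι => ∏ i, μ (ω i))
      (fun ω => Ψ (condExp (fun ω : Fin n → ι => ∏ i, μ (ω i)) (fun ω => f (∑ i, v (ω i)))
          (fun ω => ∑ i, if i.val < m then v (ω i) else 0) ω))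
      = (shiftAvg μ v ^ m) (Ψ ∘ (shiftAvg μ v ^ (n - m)) f) 0 := by
    rw [← expect_partialSum hμ1 hmn]
    refine Finset.sum_congr rfl fun ω _ => ?_
    by_cases hω : ∏ i, μ (ω i) = 0
    · simp [hω]
    · beta_reduce
      rw [condExp_totalSum hμ0 hμ1 hmn f ω hω, Function.comp_apply]
  have hid := key id
  simp only [id_eq, Function.id_comp] at hid
  rw [← Module.End.mul_apply, ← pow_add, Nat.add_sub_cancel' hmn] at hid
  rw [Hphi, key Φ]
  exact congrArg (fun z => _ - Φ z) hid

end ShiftAvg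

/-- The Φ-entropy functional is convex, for any finite weights. -/
lemma ClassF.convexOn_entropy (F : ClassF) {ι : Type*} (s : Finset ι) (w : ι → ℝ)
    (hw0 : ∀ i ∈ s, 0 ≤ w i) (hw1 : ∑ i ∈ s, w i = 1) :
    ConvexOn ℝ {u : ι → ℝ | ∀ i, u i ∈ F.D}
      (fun u => ∑ i ∈ s, w i * F.Φ (u i) - F.Φ (∑ i ∈ s, w i * u i)) := by
  classical
  have hconv : Convex ℝ {u : ι → ℝ | ∀ i, u i ∈ F.D} :=
    fun u hu u' hu' a b ha hb hab i => F.convex_dom (hu i) (hu' i) ha hb hab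
  induction s using Finset.induction_on generalizing w with
  | empty => simp at hw1
  | insert a s has ih =>
    rw [Finset.sum_insert has] at hw1
    have ha0 := hw0 a (Finset.mem_insert_self _ _)
    have hs0 : ∀ i ∈ s, 0 ≤ w i := fun i hi => hw0 i (Finset.mem_insert_of_mem hi)
    have hsum := Finset.sum_nonneg hs0
    simp only [Finset.sum_insert has]
    rcases hsum.eq_or_lt with h0 | hpos
    · have hz := (Finset.sum_eq_zero_iff_of_nonneg hs0).1 h0.symm
      have ha1 : w a = 1 := by linarith
      have hz' (g : ι → ℝ) : ∑ i ∈ s, w i * g i = 0 :=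
        Finset.sum_eq_zero fun i hi => by rw [hz i hi, zero_mul]
      simpa [ha1, hz'] using convexOn_const (0 : ℝ) hconv
    · set q := ∑ i ∈ s, w i with hq
      have hqne := hpos.ne'
      let w' : ι → ℝ := fun i => w i / q
      have hw'0 : ∀ i ∈ s, 0 ≤ w' i := fun i hi => div_nonneg (hs0 i hi) hpos.le
      have hw'1 : ∑ i ∈ s, w' i = 1 := by
        rw [← Finset.sum_div, ← hq, div_self hqne]
      have hrest := (ih w' hw'0 hw'1).smul hpos.le
      let L : (ι → ℝ) →ₗ[ℝ] ℝ × ℝ :=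
        (LinearMap.proj a).prod (∑ i ∈ s, w' i • LinearMap.proj i)
      have hL (u : ι → ℝ) : L u = (u a, ∑ i ∈ s, w' i * u i) := by
        simp [L]
      have htwo := ((F.joint_convex (w a) ⟨ha0, by linarith⟩).comp_linearMap L).subset
        (s := {u : ι → ℝ | ∀ i, u i ∈ F.D}) (fun u hu => by
          rw [Set.mem_preimage, hL]
          exact ⟨hu a, F.convex_dom.sum_mem hw'0 hw'1 fun i _ => hu i⟩) hconv
      have hmul (g : ι → ℝ) : q * ∑ i ∈ s, w' i * g i = ∑ i ∈ s, w i * g i := by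
        rw [Finset.mul_sum]
        refine Finset.sum_congr rfl fun i _ => ?_
        simp only [w']
        field_simp
      refine (htwo.add hrest).congr fun u _ => ?_
      have h1q : 1 - w a = q := by linarith
      simp only [Pi.add_apply, Function.comp_apply, hL, h1q, smul_eq_mul, mul_sub, hmul]
      ring

section UpperBound

variable {ι : Type*} [Fintype ι] {μ v : ι → ℝ}

lemma ClassF.two_mul_shiftAvg_le (F : ClassF) (hμ0 : ∀ x, 0 ≤ μ x) (hμ1 : ∑ x, μ x = 1)
    {g : ℝ → ℝ} (hg : ∀ s, g s ∈ F.D) (s : ℝ) :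
    2 * shiftAvg μ v (F.Φ ∘ shiftAvg μ v g) s
      ≤ shiftAvg μ v (shiftAvg μ v (F.Φ ∘ g)) s + F.Φ (shiftAvg μ v (shiftAvg μ v g) s) := by
  have h := (F.convexOn_entropy Finset.univ μ (fun x _ => hμ0 x) hμ1).map_sum_le
    (t := Finset.univ) (w := μ) (p := fun y x => g (s + v y + v x))
    (fun x _ => hμ0 x) hμ1 (fun y _ x => hg _)
  have hswap (x : ι) : ∑ y, μ y * g (s + v y + v x) = shiftAvg μ v g (s + v x) := by
    rw [shiftAvg_apply]
    exact Finset.sum_congr rfl fun y _ => by rw [add_right_comm]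
  simp only [Finset.sum_apply, Pi.smul_apply, smul_eq_mul, hswap, mul_sub,
    Finset.sum_sub_distrib] at h
  simp only [shiftAvg_apply, Function.comp_apply] at h ⊢
  linarith

lemma mul_sub_le_of_increments_mono {a : ℕ → ℝ} {n m : ℕ} (hm : 1 ≤ m) (hmn : m ≤ n)
    (h : ∀ k, k + 2 ≤ n → 2 * a (k + 1) ≤ a (k + 2) + a k) :
    n * (a m - a 0) ≤ m * (a n - a 0) := by
  have hinc : ∀ k, k + 1 ≤ n → a k - a 0 ≤ k * (a (k + 1) - a k) := by
    intro k
    induction k with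
    | zero => simp
    | succ k ih =>
      intro hk
      have h1 := ih (by omega)
      have h2 := mul_le_mul_of_nonneg_left (h k (by omega)) (by positivity : (0 : ℝ) ≤ k + 1)
      push_cast
      linarith
  induction n, hmn using Nat.le_induction with
  | base => exact le_rfl
  | succ j hj ih =>
    have h1 := ih (fun k hk => h k (by omega)) (fun k hk => hinc k (by omega))
    have h2 := mul_le_mul_of_nonneg_left (hinc j le_rfl) (Nat.cast_nonneg (α := ℝ) m)
    have hj0 : (0 : ℝ) < j := by exact_mod_cast (by omega : 0 < j)
    have h3 : a m - a 0 ≤ m * (a (j + 1) - a j) := by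
      refine le_of_mul_le_mul_left ?_ hj0
      linarith
    push_cast
    linarith

lemma ClassF.entropy_shiftAvg_le (F : ClassF) (hμ0 : ∀ x, 0 ≤ μ x) (hμ1 : ∑ x, μ x = 1)
    {f : ℝ → ℝ} (hf : ∀ s, f s ∈ F.D) {n m : ℕ} (hm : 1 ≤ m) (hmn : m ≤ n) (s : ℝ) :
    n * ((shiftAvg μ v ^ m) (F.Φ ∘ (shiftAvg μ v ^ (n - m)) f) s
        - F.Φ ((shiftAvg μ v ^ n) f s))
      ≤ m * ((shiftAvg μ v ^ n) (F.Φ ∘ f) s - F.Φ ((shiftAvg μ v ^ n) f s)) := by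
  have := mul_sub_le_of_increments_mono hm hmn
    (a := fun k => (shiftAvg μ v ^ k) (F.Φ ∘ (shiftAvg μ v ^ (n - k)) f) s) fun k hk => by
      obtain ⟨r, rfl⟩ := Nat.exists_eq_add_of_le hk
      have e0 : k + 2 + r - k = r + 1 + 1 := by omega
      have e1 : k + 2 + r - (k + 1) = r + 1 := by omega
      have e2 : k + 2 + r - (k + 2) = r := by omega
      simp only [e0, e1, e2]
      set g := (shiftAvg μ v ^ r) f
      have hg : ∀ s, g s ∈ F.D := shiftAvg_pow_mem hμ0 hμ1 F.convex_dom hf r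
      have hstep := shiftAvg_pow_mono (v := v) hμ0
        (f := (2 : ℝ) • shiftAvg μ v (F.Φ ∘ shiftAvg μ v g))
        (g := shiftAvg μ v (shiftAvg μ v (F.Φ ∘ g)) + F.Φ ∘ shiftAvg μ v (shiftAvg μ v g))
        (fun s => F.two_mul_shiftAvg_le hμ0 hμ1 hg s) k s
      rw [map_smul, map_add] at hstep
      have p1 : (shiftAvg μ v ^ (r + 1)) f = shiftAvg μ v g := by
        rw [pow_succ', Module.End.mul_apply]
      have p2 : (shiftAvg μ v ^ (r + 1 + 1)) f = shiftAvg μ v (shiftAvg μ v g) := by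
        rw [pow_succ', Module.End.mul_apply, p1]
      rw [p1, p2, pow_succ (shiftAvg μ v) (k + 1), pow_succ (shiftAvg μ v) k]
      simpa only [Module.End.mul_apply, Pi.add_apply, Pi.smul_apply, smul_eq_mul] using hstep
  simpa using this

end UpperBound

/-- A non-affine member of the class has a point of strictly positive second-order growth. -/
lemma ClassF.exists_quadratic_expansion (F : ClassF) :
    ∃ a ∈ interior F.D, ∃ b c : ℝ, 0 < c ∧
      Filter.Tendsto (fun t => (F.Φ (a + t) - F.Φ a - b * t) / t ^ 2)
        (nhdsWithin 0 {0}ᶜ) (nhds c) := by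
  have hne : (interior F.D).Nonempty := by
    rw [← F.convex_dom.nontrivial_iff_nonempty_interior]
    by_contra hnt
    rw [Set.not_nontrivial_iff] at hnt
    rcases hnt.eq_empty_or_singleton with h | ⟨x, h⟩
    · exact F.not_affine ⟨0, 0, by simp [h]⟩
    · exact F.not_affine ⟨0, F.Φ x, by simp [h]⟩
  have hopen : IsOpen (interior F.D) := isOpen_interior
  have hconv : Convex ℝ (interior F.D) := F.convex_dom.interior
  have hsm : ContDiffOn ℝ (⊤ : ℕ∞) F.Φ (interior F.D) := F.smooth.mono interior_subset
  have hlim : ∀ a ∈ interior F.D,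
      Filter.Tendsto (fun t => (F.Φ (a + t) - F.Φ a - deriv F.Φ a * t) / t ^ 2)
        (nhdsWithin 0 {0}ᶜ) (nhds (deriv (deriv F.Φ) a / 2)) := by
    intro a ha
    have ht := Real.taylor_tendsto (n := 2) hconv ha (contDiffOn_infty.1 hsm 2)
    rw [hopen.nhdsWithin_eq ha] at ht
    have hsh : Filter.Tendsto (fun t : ℝ => a + t) (nhdsWithin 0 {0}ᶜ) (nhds a) := by
      have : Filter.Tendsto (fun t : ℝ => a + t) (nhds 0) (nhds (a + 0)) :=
        (continuous_const.add continuous_id).tendsto 0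
      rw [add_zero] at this
      exact this.mono_left nhdsWithin_le_nhds
    have ht' := (ht.comp hsh).add_const (deriv (deriv F.Φ) a / 2)
    rw [zero_add] at ht'
    refine ht'.congr' ?_
    filter_upwards [self_mem_nhdsWithin] with t ht0
    have ht0 : t ≠ 0 := ht0
    have hd1 : derivWithin F.Φ (interior F.D) a = deriv F.Φ a := derivWithin_of_isOpen hopen ha
    have hd2 : iteratedDerivWithin 2 F.Φ (interior F.D) a = deriv (deriv F.Φ) a := by
      rw [iteratedDerivWithin_of_isOpen hopen ha, iteratedDeriv_succ, iteratedDeriv_one]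
    simp only [Function.comp_apply, taylorWithinEval_succ, taylor_within_zero_eval, zero_add,
      iteratedDerivWithin_one, hd1, hd2, one_add_one_eq_two, smul_eq_mul]
    norm_num
    field_simp
    ring
  obtain ⟨a, ha, hpos⟩ : ∃ a ∈ interior F.D, deriv (deriv F.Φ) a ≠ 0 := by
    by_contra! hzero
    have hdiff : DifferentiableOn ℝ F.Φ (interior F.D) := hsm.differentiableOn (by simp)
    have hdiff' : DifferentiableOn ℝ (deriv F.Φ) (interior F.D) :=
      ((contDiffOn_infty_iff_deriv_of_isOpen hopen).1 hsm).2.differentiableOn (by simp)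
    obtain ⟨b, hb⟩ := hopen.exists_is_const_of_deriv_eq_zero hconv.isPreconnected hdiff' hzero
    have hdl (x : ℝ) : HasDerivAt (fun t : ℝ => b * t) b x := by
      simpa using (hasDerivAt_id x).const_mul b
    obtain ⟨d, hd⟩ := hopen.exists_is_const_of_deriv_eq_zero (f := fun t => F.Φ t - b * t)
      hconv.isPreconnected (hdiff.sub fun x _ => (hdl x).differentiableAt.differentiableWithinAt)
      fun x hx => by
        have := ((hdiff.differentiableAt (hopen.mem_nhds hx)).hasDerivAt.sub (hdl x)).deriv
        simpa [hb x hx] using! this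
    refine F.not_affine ⟨b, d, ?_⟩
    refine Set.EqOn.of_subset_closure (s := interior F.D)
      (fun x hx => ?_) F.smooth.continuousOn (by fun_prop) interior_subset ?_
    · linarith [hd x hx]
    · rw [F.convex_dom.closure_interior_eq_closure_of_nonempty_interior hne]
      exact subset_closure
  refine ⟨a, ha, deriv F.Φ a, deriv (deriv F.Φ) a / 2, ?_, hlim a ha⟩
  have hneg : Filter.Tendsto (fun t : ℝ => -t) (nhdsWithin 0 {0}ᶜ) (nhdsWithin 0 {0}ᶜ) := by
    refine tendsto_nhdsWithin_of_tendsto_nhds_of_eventually_within _ ?_ ?_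
    · simpa using (continuous_neg.tendsto (0 : ℝ)).mono_left nhdsWithin_le_nhds
    · filter_upwards [self_mem_nhdsWithin] with t ht
      simpa using ht
  have hsym := (hlim a ha).add ((hlim a ha).comp hneg)
  have hnn : 0 ≤ deriv (deriv F.Φ) a / 2 + deriv (deriv F.Φ) a / 2 := by
    refine ge_of_tendsto hsym ?_
    have hnear : ∀ᶠ t in nhdsWithin (0 : ℝ) {0}ᶜ, a + t ∈ interior F.D := by
      refine Filter.Eventually.filter_mono nhdsWithin_le_nhds ?_
      refine (continuous_const.add continuous_id).continuousAt.eventually_mem ?_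
      exact hopen.mem_nhds (by simpa using ha)
    filter_upwards [hnear, hneg.eventually hnear] with t h1 h2
    have hc := F.convexOn.2 (interior_subset h1) (interior_subset h2)
      (by norm_num : (0 : ℝ) ≤ 1 / 2) (by norm_num : (0 : ℝ) ≤ 1 / 2) (by norm_num)
    have he : (1 / 2 : ℝ) • (a + t) + (1 / 2 : ℝ) • (a + -t) = a := by
      simp only [smul_eq_mul]; ring
    rw [he, smul_eq_mul, smul_eq_mul] at hc
    simp only [Function.comp_apply, neg_sq]
    rw [← add_div]
    refine div_nonneg ?_ (sq_nonneg t)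
    linarith
  exact lt_of_le_of_ne (by linarith) (div_ne_zero hpos two_ne_zero).symm

lemma var_pos {ι : Type*} [Fintype ι] {μ v : ι → ℝ} (hμ0 : ∀ x, 0 ≤ μ x)
    (hnondeg : ∃ x x', 0 < μ x ∧ 0 < μ x' ∧ v x ≠ v x') : 0 < var μ v := by
  obtain ⟨x, x', hx, hx', hne⟩ := hnondeg
  have key (y : ι) (hy : 0 < μ y) (hv : v y ≠ expect μ v) : 0 < var μ v :=
    Finset.sum_pos' (fun z _ => mul_nonneg (hμ0 z) (sq_nonneg _))
      ⟨y, Finset.mem_univ _, mul_pos hy (by have := sub_ne_zero.2 hv; positivity)⟩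
  by_cases h : v x = expect μ v
  · exact key x' hx' fun h' => hne (h.trans h'.symm)
  · exact key x hx h

section LowerBound

variable {ι : Type*} [Fintype ι] {μ v : ι → ℝ}

/-- Second-order behaviour of the Φ-entropy of small affine perturbations of a constant. -/
lemma tendsto_entropy_div_sq (hμ1 : ∑ x, μ x = 1) {Φ : ℝ → ℝ} {a b c : ℝ}
    (h : Filter.Tendsto (fun t => (Φ (a + t) - Φ a - b * t) / t ^ 2)
      (nhdsWithin 0 {0}ᶜ) (nhds c)) (k : ℕ) :
    Filter.Tendsto (fun ε : ℝ => ((shiftAvg μ v ^ k)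
        (fun s => Φ (a + ε * (s - k * ∑ x, μ x * v x))) 0 - Φ a) / ε ^ 2)
      (nhdsWithin 0 {0}ᶜ) (nhds (c * (k * var μ v))) := by
  set e := k * ∑ x, μ x * v x with he
  have hpt (s : ℝ) : Filter.Tendsto
      (fun ε : ℝ => (Φ (a + ε * (s - e)) - Φ a - b * (ε * (s - e))) / ε ^ 2)
      (nhdsWithin 0 {0}ᶜ) (nhds (c * (s - e) ^ 2)) := by
    by_cases hs : s - e = 0
    · simp [hs]
    · have hscale : Filter.Tendsto (fun ε : ℝ => ε * (s - e))
          (nhdsWithin 0 {0}ᶜ) (nhdsWithin 0 {0}ᶜ) := by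
        refine tendsto_nhdsWithin_of_tendsto_nhds_of_eventually_within _ ?_ ?_
        · have : Filter.Tendsto (fun ε : ℝ => ε * (s - e)) (nhds 0) (nhds (0 * (s - e))) :=
            (continuous_id.mul continuous_const).tendsto 0
          rw [zero_mul] at this
          exact this.mono_left nhdsWithin_le_nhds
        · filter_upwards [self_mem_nhdsWithin] with t ht
          exact mul_ne_zero ht hs
      refine ((h.comp hscale).mul_const ((s - e) ^ 2)).congr' ?_
      filter_upwards [self_mem_nhdsWithin] with t ht
      have ht : t ≠ 0 := ht
      simp only [Function.comp_apply]
      field_simp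
  have hT := shiftAvg_pow_tendsto (μ := μ) (v := v) hpt k 0
  have hsq : (shiftAvg μ v ^ k) (fun s => c * (s - e) ^ 2) 0 = c * (k * var μ v) := by
    have := shiftAvg_pow_sq (v := v) hμ1 e k 0
    rw [← he, zero_add, sub_self, zero_pow two_ne_zero, zero_add] at this
    rw [← this]
    exact congrFun (map_smul (shiftAvg μ v ^ k) c (fun s => (s - e) ^ 2)) 0
  rw [hsq] at hT
  refine hT.congr fun ε => ?_
  have hfun : (fun s => (Φ (a + ε * (s - e)) - Φ a - b * (ε * (s - e))) / ε ^ 2)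
      = (ε ^ 2)⁻¹ • ((fun s => Φ (a + ε * (s - e))) - (fun _ => Φ a)
        - (b * ε) • fun s => s - e) := by
    ext s
    simp only [Pi.smul_apply, Pi.sub_apply, smul_eq_mul]
    ring
  rw [hfun, map_smul, map_sub, map_sub, map_smul]
  simp only [Pi.smul_apply, Pi.sub_apply, smul_eq_mul, shiftAvg_pow_const hμ1,
    shiftAvg_pow_sub_const hμ1, ← he]
  ring

lemma shiftAvg_pow_affine (hμ1 : ∑ x, μ x = 1) (a ε d : ℝ) (k : ℕ) (s : ℝ) :
    (shiftAvg μ v ^ k) (fun t => a + ε * (t - d)) s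
      = a + ε * (s + k * ∑ x, μ x * v x - d) := by
  have : (fun t => a + ε * (t - d)) = (fun _ => a) + ε • fun t => t - d := rfl
  rw [this, map_add, map_smul]
  simp only [Pi.add_apply, Pi.smul_apply, smul_eq_mul, shiftAvg_pow_const hμ1,
    shiftAvg_pow_sub_const hμ1]

end LowerBound

/-- Let `X_1, …, X_n` be i.i.d. random variables taking finitely many real
values (law `μ` on a finite index type, values `v`, not almost surely constant), and let
`S_ℓ = X_1 + ⋯ + X_ℓ`. Then for every `1 ≤ m ≤ n` and `Φ ∈ 𝓕`, `η_Φ(S_n, S_m) = m/n`. -/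
theorem etaPhi_sum_iid
    {ι : Type} [Fintype ι] (μ : ι → ℝ) (hμ0 : ∀ x, 0 ≤ μ x) (hμ1 : ∑ x, μ x = 1)
    (v : ι → ℝ) (hnondeg : ∃ x x', 0 < μ x ∧ 0 < μ x' ∧ v x ≠ v x')
    (n m : ℕ) (hm : 1 ≤ m) (hmn : m ≤ n) (F : ClassF) :
    etaPhiRV F.Φ F.D (fun ω : Fin n → ι => ∏ i, μ (ω i))
        (fun ω => ∑ i, v (ω i))
        (fun ω => ∑ i, if i.val < m then v (ω i) else 0)
      = (m : ℝ) / n := by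
  have hn : (0 : ℝ) < n := by exact_mod_cast (by omega : 0 < n)
  obtain ⟨a, ha, b, c, hc, hlim⟩ := F.exists_quadratic_expansion
  have haD : a ∈ F.D := interior_subset ha
  refine IsLeast.csInf_eq ⟨⟨by positivity, fun f hf => ?_⟩, fun l hl => ?_⟩
  · classical
    let f' : ℝ → ℝ := fun s => if f s ∈ F.D then f s else a
    have hf' : ∀ s, f' s ∈ F.D := fun s => by
      simp only [f']
      split_ifs with h
      exacts [h, haD]
    have heq : (fun ω : Fin n → ι => f (∑ i, v (ω i))) = fun ω => f' (∑ i, v (ω i)) := by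
      ext ω
      exact (if_pos (hf ω)).symm
    rw [heq, Hphi_totalSum, Hphi_condExp_totalSum hμ0 hμ1 F.Φ hmn, ge_iff_le,
      div_mul_eq_mul_div, le_div_iff₀ hn, mul_comm]
    exact F.entropy_shiftAvg_le hμ0 hμ1 hf' hm hmn 0
  · obtain ⟨-, hl⟩ := hl
    set e := ∑ x, μ x * v x with he
    have hvar := var_pos hμ0 hnondeg
    have hsmall : ∀ᶠ ε in nhdsWithin (0 : ℝ) {0}ᶜ,
        ∀ ω : Fin n → ι, a + ε * (∑ i, v (ω i) - n * e) ∈ F.D := by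
      refine Filter.Eventually.filter_mono nhdsWithin_le_nhds (Filter.eventually_all.2 fun ω => ?_)
      have hcont : ContinuousAt (fun ε : ℝ => a + ε * (∑ i, v (ω i) - n * e)) 0 := by fun_prop
      refine (hcont.eventually_mem (s := interior F.D) (isOpen_interior.mem_nhds ?_)).mono
        fun _ h => interior_subset h
      simpa using ha
    have hle : c * (m * var μ v) ≤ l * (c * (n * var μ v)) := by
      refine le_of_tendsto_of_tendsto (tendsto_entropy_div_sq hμ1 hlim m)
        ((tendsto_entropy_div_sq hμ1 hlim n).const_mul l) ?_
      filter_upwards [hsmall] with ε hε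
      have h := hl (fun s => a + ε * (s - n * e)) hε
      have hcond : (shiftAvg μ v ^ (n - m)) (fun s => a + ε * (s - n * e))
          = fun s => a + ε * (s - m * e) := by
        ext s
        rw [shiftAvg_pow_affine hμ1, Nat.cast_sub hmn]
        ring
      have hmean : (shiftAvg μ v ^ n) (fun s => a + ε * (s - n * e)) 0 = a := by
        rw [shiftAvg_pow_affine hμ1]
        ring
      rw [Hphi_totalSum F.Φ n (fun s => a + ε * (s - n * e)),
        Hphi_condExp_totalSum hμ0 hμ1 F.Φ hmn (fun s => a + ε * (s - n * e)), hcond, hmean] at h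
      rw [mul_div_assoc']
      exact div_le_div_of_nonneg_right h (sq_nonneg ε)
    rw [div_le_iff₀ hn]
    refine le_of_mul_le_mul_left ?_ (mul_pos hc hvar)
    linarith

end
end

section
/- Equivalent characterization of the maximal correlation ribbon: a tuple (λ_1, …, λ_k) ∈ [0,1]^k with all λ_i > 0 belongs to 𝔖(X_1, …, X_k) if and only if for all real-valued functions f_1(X_1), …, f_k(X_k), one has Var[f_1 + ⋯ + f_k] ≤ Σ_{i=1}^k (1/λ_i) Var[f_i]. -/
open Finset

noncomputable section

/-- The maximal correlation ribbon `𝔖(X_1, …, X_k)` of a joint pmf `p`: all tuples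
`λ ∈ [0,1]^k` such that `Var[f] ≥ Σ_i λ_i Var[E[f | X_i]]` for every real-valued `f`. -/
def mcRibbon {k : ℕ} {α : Fin k → Type} [∀ i, Fintype (α i)]
    (p : (∀ i, α i) → ℝ) : Set (Fin k → ℝ) :=
  {l | (∀ i, l i ∈ Set.Icc (0:ℝ) 1) ∧ ∀ f : (∀ i, α i) → ℝ,
    var p f ≥ ∑ i, l i * var p (condExp p f (fun ω => ω i))}
/-- Covariance of `f` and `g` under the pmf `p`. -/
def cov {Ω : Type*} [Fintype Ω] (p : Ω → ℝ) (f g : Ω → ℝ) : ℝ :=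
  expect p (fun ω => f ω * g ω) - expect p f * expect p g

section Covariance

variable {Ω : Type*} [Fintype Ω] {p : Ω → ℝ}

lemma var_eq_cov (hp : IsPMF p) (f : Ω → ℝ) : var p f = cov p f f := by
  have h : ∀ m : ℝ, ∑ ω, p ω * (f ω - m) ^ 2
      = ∑ ω, p ω * (f ω * f ω) - 2 * m * ∑ ω, p ω * f ω + m ^ 2 * ∑ ω, p ω := by
    intro m
    rw [mul_sum, mul_sum, ← sum_sub_distrib, ← sum_add_distrib]
    exact sum_congr rfl fun ω _ => by ring
  rw [var, h, hp.2, cov]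
  simp only [_root_.expect]
  ring

lemma var_nonneg (hp : IsPMF p) (f : Ω → ℝ) : 0 ≤ var p f :=
  sum_nonneg fun ω _ => mul_nonneg (hp.1 ω) (sq_nonneg _)

lemma cov_sum_right {ι : Type*} (s : Finset ι) (f : Ω → ℝ) (g : ι → Ω → ℝ) :
    cov p f (fun ω => ∑ i ∈ s, g i ω) = ∑ i ∈ s, cov p f (g i) := by
  simp only [cov, _root_.expect, mul_sum, sum_sub_distrib]
  congr 1 <;> rw [sum_comm]

lemma cov_const_mul_right (c : ℝ) (f g : Ω → ℝ) :
    cov p f (fun ω => c * g ω) = c * cov p f g := by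
  simp only [cov, _root_.expect, mul_left_comm _ c, ← mul_sum, mul_sub]

lemma var_const_mul (hp : IsPMF p) (c : ℝ) (f : Ω → ℝ) :
    var p (fun ω => c * f ω) = c ^ 2 * var p f := by
  simp only [var_eq_cov hp, cov, _root_.expect, mul_left_comm _ c, mul_assoc, ← mul_sum]
  ring

lemma var_sub (hp : IsPMF p) (f g : Ω → ℝ) :
    var p (fun ω => f ω - g ω) = var p f - 2 * cov p f g + var p g := by
  have h : ∑ ω, p ω * ((f ω - g ω) * (f ω - g ω)) = ∑ ω, p ω * (f ω * f ω)
      - 2 * ∑ ω, p ω * (f ω * g ω) + ∑ ω, p ω * (g ω * g ω) := by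
    rw [mul_sum, ← sum_sub_distrib, ← sum_add_distrib]
    exact sum_congr rfl fun ω _ => by ring
  simp only [var_eq_cov hp, cov, _root_.expect]
  rw [h]
  simp only [mul_sub, sum_sub_distrib]
  ring

lemma cov_comm (f g : Ω → ℝ) : cov p f g = cov p g f := by
  simp only [cov, mul_comm]

/-- Young's inequality for the covariance. -/
lemma two_mul_cov_le (hp : IsPMF p) {c : ℝ} (hc : 0 < c) (f g : Ω → ℝ) :
    2 * cov p f g ≤ c * var p f + (1 / c) * var p g := by
  have h := var_nonneg hp (fun ω => c * f ω - g ω)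
  rw [var_sub hp, var_const_mul hp, cov_comm, cov_const_mul_right, cov_comm] at h
  have h' : c * var p f + (1 / c) * var p g - 2 * cov p f g
      = (1 / c) * (c ^ 2 * var p f - 2 * (c * cov p f g) + var p g) := by
    field_simp
    ring
  have := mul_nonneg (one_div_pos.mpr hc).le h
  linarith

variable {β : Type*}

lemma expect_condExp_mul [Fintype β] (hp : IsPMF p) (f : Ω → ℝ) (X : Ω → β) (g : β → ℝ) :
    expect p (fun ω => condExp p f X ω * g (X ω)) = expect p (fun ω => f ω * g (X ω)) := by
  classical
  simp only [_root_.expect]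
  rw [← sum_fiberwise univ X, ← sum_fiberwise univ X]
  refine sum_congr rfl fun b _ => ?_
  set N := ∑ ω with X ω = b, p ω * f ω with hN
  set D := ∑ ω with X ω = b, p ω with hD
  have hl : ∑ ω with X ω = b, p ω * (condExp p f X ω * g (X ω)) = D * (N / D * g b) := by
    rw [hD, sum_mul, ← hD]
    refine sum_congr rfl fun ω hω => ?_
    obtain rfl : X ω = b := (mem_filter.mp hω).2
    rw [hN, hD, sum_filter, sum_filter, condExp]
  have hr : ∑ ω with X ω = b, p ω * (f ω * g (X ω)) = N * g b := by
    rw [hN, sum_mul]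
    refine sum_congr rfl fun ω hω => ?_
    rw [(mem_filter.mp hω).2, mul_assoc]
  have hND : D = 0 → N = 0 := fun h => sum_eq_zero fun ω hω => by
    rw [(sum_eq_zero_iff_of_nonneg fun ω _ => hp.1 ω).mp h ω hω, zero_mul]
  rw [hl, hr, ← mul_assoc, mul_div_cancel_of_imp' hND]

lemma expect_condExp [Fintype β] (hp : IsPMF p) (f : Ω → ℝ) (X : Ω → β) :
    expect p (condExp p f X) = expect p f := by
  simpa using expect_condExp_mul hp f X (fun _ => 1)

lemma cov_condExp [Fintype β] (hp : IsPMF p) (f : Ω → ℝ) (X : Ω → β) (g : β → ℝ) :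
    cov p (condExp p f X) (fun ω => g (X ω)) = cov p f (fun ω => g (X ω)) := by
  rw [cov, cov, expect_condExp_mul hp, expect_condExp hp]

open scoped Classical in
lemma exists_condExp_eq_comp (p f : Ω → ℝ) (X : Ω → β) :
    ∃ g : β → ℝ, condExp p f X = fun ω => g (X ω) :=
  ⟨fun b => (∑ ω', if X ω' = b then p ω' * f ω' else 0) /
    (∑ ω', if X ω' = b then p ω' else 0), rfl⟩

lemma cov_condExp_self [Fintype β] (hp : IsPMF p) (f : Ω → ℝ) (X : Ω → β) :
    cov p f (condExp p f X) = var p (condExp p f X) := by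
  obtain ⟨g, hg⟩ := exists_condExp_eq_comp p f X
  have h := cov_condExp hp f X g
  rw [← hg] at h
  rw [var_eq_cov hp, h]

end Covariance

/-- Equivalent characterization of the MC ribbon: a tuple
`λ ∈ [0,1]^k` with all `λ_i > 0` belongs to `𝔖(X_1, …, X_k)` iff for all functions
`f_1(X_1), …, f_k(X_k)`, `Var[f_1 + ⋯ + f_k] ≤ Σ_i (1/λ_i) Var[f_i]`. -/
theorem mcRibbon_iff_sum_var
    {k : ℕ} {α : Fin k → Type} [∀ i, Fintype (α i)]
    (p : (∀ i, α i) → ℝ) (hp : IsPMF p)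
    (l : Fin k → ℝ) (hl : ∀ i, l i ∈ Set.Ioc (0:ℝ) 1) :
    l ∈ mcRibbon p ↔
      ∀ f : (i : Fin k) → α i → ℝ,
        var p (fun ω => ∑ j, f j (ω j))
          ≤ ∑ i, (1 / l i) * var p (fun ω => f i (ω i)) := by
  constructor
  · rintro ⟨-, hvar⟩ f
    set F : (∀ i, α i) → ℝ := fun ω => ∑ j, f j (ω j) with hF
    have hsum : 2 * var p F ≤ ∑ i, (l i * var p (condExp p F (fun ω => ω i))
        + (1 / l i) * var p (fun ω => f i (ω i))) := by
      rw [var_eq_cov hp]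
      nth_rewrite 2 [hF]
      rw [cov_sum_right univ F fun i ω => f i (ω i), mul_sum]
      refine sum_le_sum fun i _ => ?_
      rw [← cov_condExp hp F (fun ω => ω i) (f i)]
      exact two_mul_cov_le hp (hl i).1 _ _
    rw [sum_add_distrib] at hsum
    linarith [hvar F]
  · refine fun h => ⟨fun i => Set.Ioc_subset_Icc_self (hl i), fun f => ?_⟩
    choose g hg using fun i => exists_condExp_eq_comp p f (fun ω : ∀ i, α i => ω i)
    have hG := h fun i a => l i * g i a
    have hvar : ∀ i, (1 / l i) * var p (fun ω => l i * g i (ω i))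
        = l i * var p (condExp p f (fun ω => ω i)) := fun i => by
      have := (hl i).1.ne'
      rw [var_const_mul hp, ← hg]
      field_simp
    have hcov : cov p f (fun ω => ∑ i, l i * g i (ω i))
        = ∑ i, l i * var p (condExp p f (fun ω => ω i)) := by
      rw [cov_sum_right univ f fun i ω => l i * g i (ω i)]
      refine sum_congr rfl fun i _ => ?_
      rw [cov_const_mul_right, ← hg, cov_condExp_self hp]
    simp only [hvar] at hG
    have hsub := var_nonneg hp fun ω => f ω - ∑ i, l i * g i (ω i)
    rw [var_sub hp, hcov] at hsub
    linarith

end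
end
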